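/- Let p be an odd prime and let t ≥ 3 be an integer. Set n = 2p^t and suppose d = n^2 + 1 is squarefree with d ≡ 5 (mod 8) and the class number of Q(√d) equals 4. Then (1/60) · Σ σ((d − t²)/4), the sum taken over all integers t with t² < d and t² ≡ d (mod 4), equals (n³ + 14n)/360 + (n³ + n(4p⁴ + 10p²))/(180p²) + (n³ + n(4p⁸ + 10p⁴))/(360p⁴). -/

import Mathlib

lemma zv_dvd_or {p : ℕ} (hp : p.Prime) (k : ℕ) (j : ℤ) (h : (p:ℤ)^k ∣ j * (j+1)) :
    (p:ℤ)^k ∣ j ∨ (p:ℤ)^k ∣ j + 1 := by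
  have hp' : Prime (p:ℤ) := Nat.prime_iff_prime_int.mp hp
  by_cases h1 : (p:ℤ) ∣ j
  · left
    have h2 : ¬ (p:ℤ) ∣ j+1 := by
      intro h2
      have := (Int.dvd_add_right h1).mp h2
      exact hp'.not_dvd_one this
    exact hp'.pow_dvd_of_dvd_mul_right k h2 h
  · right
    exact hp'.pow_dvd_of_dvd_mul_left k h1 h

lemma zv_bounds {N j : ℤ} (hN : 0 < N) (h : j * (j+1) < N^2) : -N ≤ j ∧ j ≤ N - 1 := by
  constructor
  · by_contra hc
    have : j + 1 ≤ -N := by omega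
    nlinarith
  · by_contra hc
    have : N ≤ j := by omega
    nlinarith

lemma zv_step {N m M j c a : ℤ} (hm : 0 < m) (hM : 0 < M) (hmM : m * M = N)
    (hc : 0 < c) (h : m * c + j * (j+1) = N^2) (ha : 0 < a) (hae : a = m - (2*j+1) - c)
    (hd : m ∣ j ∨ m ∣ j + 1) : c = M ∨ a = M := by
  have hN : 0 < N := by rw [← hmM]; positivity
  have hmc : 0 < m * c := by positivity
  have hma : 0 < m * a := by positivity
  obtain ⟨h1, h2⟩ := zv_bounds hN (by linarith : j * (j+1) < N^2)
  have h3 : (j - m) * (j - m + 1) = N^2 + m * a := by rw [hae, ← h]; ring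
  have h4 : j - m ≤ -N - 1 := by
    by_contra hcon
    have h5 : -N ≤ j - m := by omega
    have h6 : j - m ≤ N - 1 := by omega
    nlinarith
  rcases hd with ⟨i, hi⟩ | ⟨i, hi⟩
  · left
    have hi1 : -M ≤ i := by
      by_contra hcon
      have : i + 1 ≤ -M := by omega
      nlinarith
    have hi2 : i ≤ -M := by
      by_contra hcon
      have : -M + 1 ≤ i := by omega
      nlinarith
    have hj : j = -N := by rw [hi, le_antisymm hi2 hi1, ← hmM]; ring
    rw [hj] at h
    have : m * c = m * M := by rw [hmM]; linarith
    exact mul_left_cancel₀ hm.ne' this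
  · right
    have hi1 : 1 - M ≤ i := by
      by_contra hcon
      have : i ≤ -M := by omega
      nlinarith
    have hi2 : i ≤ 1 - M := by
      by_contra hcon
      have : 2 - M ≤ i := by omega
      nlinarith
    have hi3 : i = 1 - M := le_antisymm hi2 hi1
    have hj : j = m - N - 1 := by rw [← hmM]; rw [hi3] at hi; linarith
    rw [hj] at h3
    have : m * a = m * M := by rw [hmM]; linarith
    exact mul_left_cancel₀ hm.ne' this

lemma zv_descent {N m M : ℤ} (hm : 0 < m) (hM : 0 < M) (hmM : m * M = N)
    (hdm : ∀ j : ℤ, m ∣ j * (j+1) → m ∣ j ∨ m ∣ j + 1)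
    (hdM : ∀ j : ℤ, M ∣ j * (j+1) → M ∣ j ∨ M ∣ j + 1) (s : ℕ) :
    ∀ a j c x y : ℤ, 0 < a → 0 < c → a * c + j * (j+1) = N^2 → 0 ≤ x → 0 ≤ y →
      IsCoprime x y → x + y ≤ s → |a * x^2 + (2*j+1) * x * y - c * y^2| = m →
      (a = m ∨ a = M) ∨ (c = m ∨ c = M) := by
  have hN : 0 < N := by rw [← hmM]; positivity
  have hmN : m ≤ N := by rw [← hmM]; nlinarith
  -- positive type step
  have key : ∀ a j c x y : ℤ, 0 < a → 0 < c → a * c + j * (j+1) = N^2 → 0 < x → 0 < y →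
      |a * x^2 + (2*j+1) * x * y - c * y^2| = m → 0 < a + (2*j+1) - c → x ≤ y := by
    intro a j c x y ha hc h hx hy hv hpos
    by_contra hxy
    obtain ⟨u, hu⟩ : ∃ u, u = x - y := ⟨_, rfl⟩
    have hu0 : 0 < u := by omega
    have hx' : x = u + y := by omega
    have hB : 0 < 2*a + (2*j+1) + c + (a - c) - a := by linarith
    have hB2 : 2 * N < 2*a+(2*j+1) := by
      have hsq : (2*a+(2*j+1))^2 = 4 * (a * (a + (2*j+1) - c)) + 4*N^2+1 := by
        rw [← h]; ring
      have : 0 < a * (a + (2*j+1) - c) := by positivity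
      by_contra hcon
      have h0 : 0 < 2*a+(2*j+1) := by linarith
      nlinarith
    have hval : a * x^2 + (2*j+1) * x * y - c * y^2
        = a * u^2 + (2*a+(2*j+1)) * (u * y) + (a + (2*j+1) - c) * y^2 := by rw [hx']; ring
    have huy : 1 ≤ u * y := by nlinarith
    have h1 : 0 < a * u^2 := by positivity
    have h2 : 0 < (a + (2*j+1) - c) * y^2 := by positivity
    have h3 : 2*a+(2*j+1) ≤ (2*a+(2*j+1)) * (u * y) := by nlinarith
    rw [hval, abs_of_pos (by linarith)] at hv
    linarith
  induction s with
  | zero =>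
    intro a j c x y ha hc h hx hy hco hs hv
    push_cast at hs
    have hx0 : x = 0 := by omega
    have hy0 : y = 0 := by omega
    subst hx0 hy0
    rw [isCoprime_zero_left, Int.isUnit_iff] at hco
    omega
  | succ s ih =>
    have half : ∀ a j c x y : ℤ, 0 < a → 0 < c → a * c + j * (j+1) = N^2 → 0 < x → 0 < y →
      IsCoprime x y → x + y ≤ ((s+1 : ℕ) : ℤ) → |a * x^2 + (2*j+1) * x * y - c * y^2| = m →
      0 < a + (2*j+1) - c → (a = m ∨ a = M) ∨ (c = m ∨ c = M) := by
      intro a j c x y ha hc h hx hy hco hs hv hpos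
      have hxy := key a j c x y ha hc h hx hy hv hpos
      have h1 : (a + (2*j+1) - c) * c + (j-c) * (j-c+1) = N^2 := by rw [← h]; ring
      have h2 := ih (a + (2*j+1) - c) (j - c) c x (y - x) hpos hc h1 hx.le (by omega)
        (by
          have := hco.add_mul_left_right (-1)
          rwa [show y + x * (-1) = y - x by ring] at this)
        (by push_cast at hs ⊢; omega)
        (by rw [← hv]; congr 1; ring)
      rcases h2 with (h2 | h2) | h2
      · rw [h2] at h1
        rcases zv_step hm hM hmM hc h1 ha (by rw [← h2]; ring)
          (hdm _ ⟨N * M - c, by linear_combination h1 - N * hmM⟩) with h3 | h3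
        · exact Or.inr (Or.inr h3)
        · exact Or.inl (Or.inr h3)
      · rw [h2] at h1
        rcases zv_step hM hm (by rw [mul_comm]; exact hmM) hc h1 ha (by rw [← h2]; ring)
          (hdM _ ⟨N * m - c, by linear_combination h1 - N * hmM⟩) with h3 | h3
        · exact Or.inr (Or.inl h3)
        · exact Or.inl (Or.inl h3)
      · exact Or.inr h2
    intro a j c x y ha hc h hx hy hco hs hv
    rcases hx.eq_or_lt with hx0 | hx0
    · subst hx0
      rw [isCoprime_zero_left, Int.isUnit_iff] at hco
      right; left
      rcases hco with rfl | rfl <;> simpa [abs_of_pos hc] using hv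
    rcases hy.eq_or_lt with hy0 | hy0
    · subst hy0
      rw [isCoprime_zero_right, Int.isUnit_iff] at hco
      left; left
      rcases hco with rfl | rfl <;> simpa [abs_of_pos ha] using hv
    rcases lt_trichotomy 0 (a + (2*j+1) - c) with hs1 | hs1 | hs1
    · exact half a j c x y ha hc h hx0 hy0 hco hs hv hs1
    · exfalso
      have : (a + c)^2 = 4*N^2+1 := by
        have : c = a + (2*j+1) := by linarith
        rw [← h, this]; ring
      have h1 : 2 * N < a + c := by nlinarith
      nlinarith
    · have := half c (-1-j) a y x hc ha (by rw [← h]; ring) hy0 hx0 hco.symm (by linarith)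
        (by rw [← hv, ← abs_neg]; congr 1; ring) (by linarith)
      exact this.symm

lemma zv_main_descent {p : ℕ} (hp : p.Prime) {t k : ℕ} (hk : k ≤ t) {a j c x y : ℤ}
    (ha : 0 < a) (hc : 0 < c) (h : a * c + j * (j+1) = ((p:ℤ)^t)^2) (hco : IsCoprime x y)
    (hv : |a * x^2 + (2*j+1) * x * y - c * y^2| = (p:ℤ)^k) :
    (a = (p:ℤ)^k ∨ a = (p:ℤ)^(t-k)) ∨ (c = (p:ℤ)^k ∨ c = (p:ℤ)^(t-k)) := by
  have hp0 : (0:ℤ) < p := by exact_mod_cast hp.pos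
  have H := fun s => zv_descent (N := (p:ℤ)^t) (m := (p:ℤ)^k) (M := (p:ℤ)^(t-k))
    (by positivity) (by positivity) (by rw [← pow_add]; congr 1; omega)
    (zv_dvd_or hp k) (zv_dvd_or hp (t-k)) s
  have hco' : IsCoprime |x| |y| := by
    rcases abs_choice x with h1 | h1 <;> rcases abs_choice y with h2 | h2 <;> rw [h1, h2] <;>
      simpa [IsCoprime.neg_left_iff, IsCoprime.neg_right_iff] using hco
  by_cases hxy : 0 ≤ x * y
  · refine H (|x| + |y|).toNat a j c |x| |y| ha hc h (abs_nonneg _) (abs_nonneg _) hco'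
      (Int.self_le_toNat _) ?_
    rw [← hv, sq_abs, sq_abs, mul_assoc, ← abs_mul, abs_of_nonneg hxy, ← mul_assoc]
  · refine H (|x| + |y|).toNat a (-1-j) c |x| |y| ha hc (by rw [← h]; ring) (abs_nonneg _)
      (abs_nonneg _) hco' (Int.self_le_toNat _) ?_
    rw [← hv, sq_abs, sq_abs, mul_assoc, ← abs_mul, abs_of_neg (not_le.mp hxy)]
    congr 1; ring

section ZV
open nonZeroDivisors

variable {O : Type*} [CommRing O]

lemma zv_int_dvd {θ : O} (hcoord : ∀ z : O, ∃ x y : ℤ, z = x + y * θ)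
    (huniq : ∀ x y : ℤ, (x:O) + y * θ = 0 → x = 0 ∧ y = 0) {u v : ℤ}
    (h : (u:O) ∣ (v:O)) : u ∣ v := by
  obtain ⟨z, hz⟩ := h
  obtain ⟨x, y, rfl⟩ := hcoord z
  have := huniq (v - u * x) (- (u * y)) (by push_cast; rw [hz]; ring)
  exact ⟨x, by linarith [this.1]⟩

lemma zv_mem_I {θ : O} {N : ℤ} (hθ : θ^2 = θ + (N:O)^2)
    (hcoord : ∀ z : O, ∃ x y : ℤ, z = x + y * θ) {a c j : ℤ}
    (h : a * c + j * (j+1) = N^2) {z : O} (hz : z ∈ Ideal.span {(a:O), (j:O) + θ}) :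
    ∃ x y : ℤ, z = x * a + y * (j + θ) := by
  obtain ⟨r, s, hrs⟩ := Ideal.mem_span_pair.mp hz
  obtain ⟨r1, r2, rfl⟩ := hcoord r
  obtain ⟨s1, s2, rfl⟩ := hcoord s
  have hO : (a:O) * c + j * (j+1) = (N:O)^2 := by exact_mod_cast congrArg (fun q : ℤ => (q:O)) h
  refine ⟨r1 - r2 * j + s2 * c, r2 * a + s1 + s2 * (j+1), ?_⟩
  rw [← hrs]
  push_cast
  linear_combination (s2:O) * hθ - (s2:O) * hO

lemma zv_I_mul {θ : O} {σ : O →+* O} {N : ℤ} (hθ : θ^2 = θ + (N:O)^2) (hσ : σ θ = 1 - θ)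
    (hsf : Squarefree (4*N^2+1)) {a c j : ℤ}
    (h : a * c + j * (j+1) = N^2) :
    Ideal.span {(a:O), (j:O) + θ} * Ideal.map σ (Ideal.span {(a:O), (j:O) + θ})
      = Ideal.span {(a:O)} := by
  have hO : (a:O) * c + j * (j+1) = (N:O)^2 := by exact_mod_cast congrArg (fun q : ℤ => (q:O)) h
  rw [Ideal.map_span, Set.image_pair, map_intCast, map_add, map_intCast, hσ]
  have hprod : ((j:O) + θ) * (j + (1 - θ)) = - (a * c) := by
    linear_combination hO - hθ
  -- Bezout
  obtain ⟨u, v, w, hb⟩ : ∃ u v w : ℤ, u * a + v * c + w * (2*j+1) = 1 := by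
    have hg : IsUnit (gcd (gcd a c) (2*j+1)) := by
      apply hsf
      have h1 : gcd (gcd a c) (2*j+1) ∣ a := (gcd_dvd_left _ _).trans (gcd_dvd_left _ _)
      have h2 : gcd (gcd a c) (2*j+1) ∣ c := (gcd_dvd_left _ _).trans (gcd_dvd_right _ _)
      have h3 : gcd (gcd a c) (2*j+1) ∣ 2*j+1 := gcd_dvd_right _ _
      have : 4*N^2+1 = 4 * (a * c) + (2*j+1)*(2*j+1) := by rw [← h]; ring
      rw [this]
      exact dvd_add ((mul_dvd_mul h1 h2).mul_left 4) (mul_dvd_mul h3 h3)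
    have hco : IsCoprime (gcd a c) (2*j+1) := (gcd_isUnit_iff _ _).mp hg
    obtain ⟨r, s, hrs⟩ := hco
    obtain ⟨r1, r2, hr⟩ := exists_gcd_eq_mul_add_mul a c
    exact ⟨r * r1, r * r2, s, by rw [hr] at hrs; linarith⟩
  have hbO : (u:O) * a + v * c + w * (2*j+1) = 1 := by
    exact_mod_cast congrArg (fun q : ℤ => (q:O)) hb
  apply le_antisymm
  · rw [Ideal.span_mul_span', Ideal.span_le]
    rintro _ ⟨x, hx, y, hy, rfl⟩
    simp only [Set.mem_insert_iff, Set.mem_singleton_iff] at hx hy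
    simp only [SetLike.mem_coe, Ideal.mem_span_singleton]
    rcases hx with rfl | rfl
    · exact dvd_mul_right _ _
    · rcases hy with rfl | rfl
      · exact dvd_mul_left _ _
      · simp only [hprod]
        exact ⟨-c, by ring⟩
  · rw [Ideal.span_singleton_le_iff_mem]
    have m1 : (a:O) ∈ Ideal.span {(a:O), (j:O) + θ} := Ideal.subset_span (by simp)
    have m2 : (j:O) + θ ∈ Ideal.span {(a:O), (j:O) + θ} := Ideal.subset_span (by simp)
    have m3 : (a:O) ∈ Ideal.span {(a:O), (j:O) + (1 - θ)} := Ideal.subset_span (by simp)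
    have m4 : (j:O) + (1 - θ) ∈ Ideal.span {(a:O), (j:O) + (1-θ)} := Ideal.subset_span (by simp)
    have e : (a:O) = u * (a * a) + (-v) * ((j + θ) * (j + (1-θ)))
        + w * (a * (j + (1 - θ)) + (j+θ) * a) := by
      rw [hprod]; linear_combination (-(a:O)) * hbO
    refine (congrArg (· ∈ Ideal.span {(a:O), (j:O) + θ} *
      Ideal.span {(a:O), (j:O) + (1 - θ)}) e).mpr ?_
    refine add_mem (add_mem ?_ ?_) ?_
    · exact Ideal.mul_mem_left _ _ (Ideal.mul_mem_mul m1 m3)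
    · exact Ideal.mul_mem_left _ _ (Ideal.mul_mem_mul m2 m4)
    · exact Ideal.mul_mem_left _ _ (add_mem (Ideal.mul_mem_mul m1 m4) (Ideal.mul_mem_mul m2 m3))

/-- A principal product `I P^k` yields a representation of `± p^k` by the form of `I`. -/
lemma zv_repr [IsDomain O] {θ : O} {σ : O →+* O} {N : ℤ} (hθ : θ^2 = θ + (N:O)^2)
    (hσ : σ θ = 1 - θ) (hcoord : ∀ z : O, ∃ x y : ℤ, z = x + y * θ)
    (huniq : ∀ x y : ℤ, (x:O) + y * θ = 0 → x = 0 ∧ y = 0)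
    (hsf : Squarefree (4*N^2+1)) {a c j : ℤ} (ha : 0 < a)
    (h : a * c + j * (j+1) = N^2) {p : ℤ} (hp : 0 < p) {c' : ℤ} (h' : p * c' = N^2) (k : ℕ) {γ : O}
    (hγ : Ideal.span {(a:O), (j:O) + θ} * Ideal.span {(p:O), θ}^k = Ideal.span {γ}) :
    ∃ x y : ℤ, γ = x * a + y * (j + θ) ∧ |a * x^2 + (2*j+1) * x * y - c * y^2| = p^k := by
  have hO : (a:O) * c + j * (j+1) = (N:O)^2 := by exact_mod_cast congrArg (fun q : ℤ => (q:O)) h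
  have hP := zv_I_mul (a := p) (c := c') (j := 0) hθ hσ hsf (by rw [← h']; ring)
  rw [Int.cast_zero, zero_add] at hP
  have hI := zv_I_mul hθ hσ hsf h
  have hmem : γ ∈ Ideal.span {(a:O), (j:O) + θ} := by
    have h1 : γ ∈ Ideal.span {(a:O), (j:O) + θ} * Ideal.span {(p:O), θ}^k := by
      rw [hγ]; exact Ideal.mem_span_singleton_self γ
    have hle : Ideal.span {(a:O), (j:O) + θ} * Ideal.span {(p:O), θ}^k ≤
        Ideal.span {(a:O), (j:O) + θ} := Ideal.mul_le_inf.trans inf_le_left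
    exact hle h1
  obtain ⟨x, y, hxy⟩ := zv_mem_I hθ hcoord h hmem
  refine ⟨x, y, hxy, ?_⟩
  have hmap := congrArg (Ideal.map σ) hγ
  rw [Ideal.map_mul, Ideal.map_pow, Ideal.map_span σ {γ}, Set.image_singleton] at hmap
  have hmul : Ideal.span {γ * σ γ} = Ideal.span {((a * p^k : ℤ):O)} := by
    rw [← Ideal.span_singleton_mul_span_singleton, ← hγ, ← hmap, mul_mul_mul_comm, hI, ← mul_pow,
      hP, Ideal.span_singleton_pow, Ideal.span_singleton_mul_span_singleton]
    push_cast; rfl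
  have hnorm : γ * σ γ = ((a * (a * x^2 + (2*j+1) * x * y - c * y^2) : ℤ) : O) := by
    rw [hxy]
    simp only [map_add, map_mul, map_intCast, hσ]
    push_cast
    linear_combination (-(y:O)^2) * hθ + (y:O)^2 * hO
  rw [hnorm] at hmul
  have d1 := zv_int_dvd hcoord huniq (Ideal.span_singleton_le_span_singleton.mp hmul.le)
  have d2 := zv_int_dvd hcoord huniq (Ideal.span_singleton_le_span_singleton.mp hmul.ge)
  have d1' := (mul_dvd_mul_iff_left ha.ne').mp d1
  have d2' := (mul_dvd_mul_iff_left ha.ne').mp d2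
  have : (p^k).natAbs = (a * x^2 + (2*j+1) * x * y - c * y^2).natAbs :=
    Int.natAbs_eq_of_dvd_dvd d1' d2'
  rw [Int.abs_eq_natAbs, ← this, Int.natAbs_of_nonneg (by positivity)]

lemma zv_pt {θ q M : O} {t : ℕ} (ht : 1 ≤ t) (hM : M = q^t) (hθ : θ^2 = θ + M^2) :
    (Ideal.span {q, θ}^t).IsPrincipal := by
  obtain ⟨P, hPdef⟩ : ∃ P : Ideal O, P = Ideal.span {q, θ} := ⟨_, rfl⟩
  have hpP : q ∈ P := hPdef ▸ Ideal.subset_span (by simp)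
  have hθP : θ ∈ P := hPdef ▸ Ideal.subset_span (by simp)
  rw [← hPdef]
  refine ⟨θ - M, ?_⟩
  have hNmem : M ∈ P^t := hM ▸ Ideal.pow_mem_pow hpP t
  change P^t = Ideal.span {θ - M}
  apply le_antisymm
  · have hN : M ∈ Ideal.span {θ - M} := by
      rw [Ideal.mem_span_singleton]
      exact ⟨θ - 1 + M, by linear_combination -hθ⟩
    have hθm : θ ∈ Ideal.span {θ - M} := by
      have := add_mem (Ideal.mem_span_singleton_self (θ - M)) hN
      rwa [sub_add_cancel] at this
    have hle : ∀ i, P^i ≤ Ideal.span {q^i} ⊔ Ideal.span {θ} := by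
      intro i
      induction i with
      | zero => simp
      | succ i ih =>
        rw [pow_succ]
        refine (Ideal.mul_mono_left ih).trans ?_
        rw [hPdef, Ideal.span_insert, Ideal.sup_mul, Ideal.mul_sup,
          Ideal.span_singleton_mul_span_singleton, ← pow_succ]
        refine sup_le (sup_le le_sup_left ?_) ?_
        · exact (Ideal.mul_le_inf.trans inf_le_right).trans le_sup_right
        · exact (Ideal.mul_le_inf.trans inf_le_left).trans le_sup_right
    refine (hle t).trans (sup_le ?_ ?_)
    · rw [Ideal.span_singleton_le_iff_mem, ← hM]; exact hN
    · rw [Ideal.span_singleton_le_iff_mem]; exact hθm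
  · rw [Ideal.span_singleton_le_iff_mem]
    have hθi : ∀ i, i + 1 ≤ t → θ ∈ P^(i+1) := by
      intro i
      induction i with
      | zero => intro _; rw [zero_add, pow_one]; exact hθP
      | succ i ih =>
        intro hi
        have h1 := ih (by omega)
        have e : θ * θ - M * M = θ := by linear_combination hθ
        have e1 : θ * θ ∈ P^(i+1+1) := by
          rw [pow_succ]; exact Ideal.mul_mem_mul h1 hθP
        have e2 : M ∈ P^(i+1+1) := by
          have hle2 : P^t ≤ P^(i+1+1) := Ideal.pow_le_pow_right hi
          exact hle2 hNmem
        have e3 := sub_mem e1 (Ideal.mul_mem_left (P^(i+1+1)) M e2)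
        rwa [e] at e3
    have := hθi (t-1) (by omega)
    rw [Nat.sub_add_cancel (by omega)] at this
    exact sub_mem this hNmem

set_option maxHeartbeats 1000000 in
lemma zv_class [IsDedekindDomain O] [Fintype (ClassGroup O)] (hcl : Fintype.card (ClassGroup O) = 4)
    {p : ℕ} (hp : p.Prime) {t : ℕ} (ht : 3 ≤ t)
    {θ : O} {σ : O →+* O} (hθ : θ^2 = θ + (((p:ℤ)^t : ℤ):O)^2)
    (hσ : σ θ = 1 - θ) (hcoord : ∀ z : O, ∃ x y : ℤ, z = x + y * θ)
    (huniq : ∀ x y : ℤ, (x:O) + y * θ = 0 → x = 0 ∧ y = 0)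
    (hsf : Squarefree (4*((p:ℤ)^t)^2+1)) :
    t = 4 ∧ ∀ a c j : ℤ, 0 < a → 0 < c → a * c + j * (j+1) = ((p:ℤ)^t)^2 →
      ∃ k ≤ 4, a = (p:ℤ)^k ∨ c = (p:ℤ)^k := by
  have hp0 : (0:ℤ) < p := by exact_mod_cast hp.pos
  have hp1 : (1:ℤ) < p := by exact_mod_cast hp.one_lt
  have hpp : Prime (p:ℤ) := Nat.prime_iff_prime_int.mp hp
  have hcp : (p:ℤ) * (p:ℤ)^(2*t-1) = ((p:ℤ)^t)^2 := by
    rw [← pow_succ', ← pow_mul]; congr 1; omega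
  have hpO : ((p:ℤ):O) ≠ 0 := by
    intro h0
    have := (huniq p 0 (by rw [h0]; simp)).1
    omega
  obtain ⟨P, hPdef⟩ : ∃ P : Ideal O, P = Ideal.span {((p:ℤ):O), θ} := ⟨_, rfl⟩
  have hpP : ((p:ℤ):O) ∈ P := hPdef ▸ Ideal.subset_span (by simp)
  have hθP : θ ∈ P := hPdef ▸ Ideal.subset_span (by simp)
  have hP0 : P ∈ (Ideal O)⁰ := mem_nonZeroDivisors_of_ne_zero (by
    intro h0
    rw [h0] at hpP
    exact hpO (by simpa using hpP))
  -- `P^k` is not principal for `0 < k < t`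
  have hnp : ∀ k, 0 < k → k < t → ¬ (P^k).IsPrincipal := by
    intro k hk0 hkt ⟨γ, hγ⟩
    have htop : Ideal.span {((1:ℤ):O), ((0:ℤ):O) + θ} = ⊤ := by
      rw [Ideal.eq_top_iff_one]; exact Ideal.subset_span (by simp)
    obtain ⟨x, y, hxy, hv⟩ := zv_repr hθ hσ hcoord huniq hsf (a := 1) (c := ((p:ℤ)^t)^2) (j := 0)
      one_pos (by ring) hp0 hcp k (γ := γ) (by rw [htop, Ideal.top_mul, ← hPdef]; exact hγ)
    have hco : IsCoprime x y := by
      rw [Int.isCoprime_iff_gcd_eq_one]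
      by_contra hg
      obtain ⟨q, hq, hqd⟩ := Nat.exists_prime_and_dvd hg
      have hqx : (q:ℤ) ∣ x := (Int.natCast_dvd_natCast.mpr hqd).trans (Int.gcd_dvd_left _ _)
      have hqy : (q:ℤ) ∣ y := (Int.natCast_dvd_natCast.mpr hqd).trans (Int.gcd_dvd_right _ _)
      have hqp : (q:ℤ) ∣ (p:ℤ)^k := by
        rw [← hv, dvd_abs]
        refine dvd_sub (dvd_add ?_ ?_) ?_
        · exact (dvd_pow hqx two_ne_zero).mul_left _
        · exact hqy.mul_left _
        · exact (dvd_pow hqy two_ne_zero).mul_left _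
      have hqp' : q = p := by
        have : q ∣ p^k := by exact_mod_cast hqp
        exact (Nat.prime_dvd_prime_iff_eq hq hp).mp (hq.dvd_of_dvd_pow this)
      subst hqp'
      obtain ⟨x', rfl⟩ := hqx
      obtain ⟨y', rfl⟩ := hqy
      have hqγ : ((q:ℤ):O) ∣ γ := ⟨x' + y' * θ, by rw [hxy]; push_cast; ring⟩
      have hθk : θ^k ∈ P^k := Ideal.pow_mem_pow hθP k
      rw [hγ] at hθk
      have hγθ : γ ∣ θ^k := Ideal.mem_span_singleton.mp hθk
      have hqθ : ∀ i, ((q:ℤ):O) ∣ θ^(i+1) - θ := by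
        intro i
        induction i with
        | zero => simp
        | succ i ih =>
          obtain ⟨z, hz⟩ := ih
          have hNq : (((q:ℤ)^t : ℤ):O) = ((q:ℤ):O) * ((q:ℤ):O)^(t-1) := by
            rw [← pow_succ', Nat.sub_add_cancel (by omega)]; push_cast; rfl
          rw [hNq] at hθ
          exact ⟨z * θ + ((q:ℤ):O)^(t-1) * (((q:ℤ):O) * ((q:ℤ):O)^(t-1)), by
            linear_combination θ * hz + hθ⟩
      have hqθ' : ((q:ℤ):O) ∣ θ := by
        have h1 := hqθ (k-1)
        rw [Nat.sub_add_cancel hk0] at h1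
        have := dvd_sub (hqγ.trans hγθ) h1
        simpa using this
      obtain ⟨z, hz⟩ := hqθ'
      obtain ⟨z1, z2, rfl⟩ := hcoord z
      have := (huniq (q * z1) (q * z2 - 1) (by push_cast at hz ⊢; linear_combination -hz)).2
      have h1 : (q:ℤ) ∣ 1 := ⟨z2, by linarith⟩
      exact hpp.not_dvd_one h1
    have h4 := zv_main_descent hp hkt.le (a := 1) (c := ((p:ℤ)^t)^2) (j := 0) one_pos
      (by positivity) (by ring) hco hv
    have hinj : ∀ a b : ℕ, (p:ℤ)^a = (p:ℤ)^b → a = b := fun a b hab =>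
      Nat.pow_right_injective hp.two_le (by exact_mod_cast hab)
    rw [← pow_mul, ← pow_zero (p:ℤ)] at h4
    rcases h4 with (h4 | h4) | (h4 | h4) <;> have := hinj _ _ h4 <;> omega
  -- `P^t` is principal
  have hpt : (P^t).IsPrincipal := by
    rw [hPdef]
    exact zv_pt (by omega) (by push_cast; rfl) hθ
  set g : ClassGroup O := ClassGroup.mk0 ⟨P, hP0⟩ with hg
  have hgk : ∀ k, g^k = 1 ↔ (P^k).IsPrincipal := by
    intro k
    rw [← ClassGroup.mk0_eq_one_iff (pow_mem hP0 k), hg, ← map_pow, SubmonoidClass.mk_pow]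
  have hord : orderOf g = t := by
    rw [orderOf_eq_iff (by omega)]
    exact ⟨(hgk t).mpr hpt, fun m hm hm0 h => hnp m hm0 hm ((hgk m).mp h)⟩
  have ht4 : t = 4 := by
    have h1 : t ∣ 4 := by rw [← hord, ← hcl]; exact orderOf_dvd_card
    have h2 := Nat.le_of_dvd (by norm_num) h1
    have h3 : t ≠ 3 := by
      intro h3
      rw [h3] at h1
      norm_num at h1
    omega
  refine ⟨ht4, ?_⟩
  intro a c j ha hc h
  have haO : (a:O) ≠ 0 := by
    intro h0
    have := (huniq a 0 (by rw [h0]; simp)).1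
    omega
  have hI0 : Ideal.span {(a:O), (j:O) + θ} ∈ (Ideal O)⁰ := mem_nonZeroDivisors_of_ne_zero (by
    intro h0
    have : (a:O) ∈ Ideal.span {(a:O), (j:O) + θ} := Ideal.subset_span (by simp)
    rw [h0] at this
    exact haO (by simpa using this))
  have hgen : ∀ x : ClassGroup O, x ∈ Subgroup.zpowers g := by
    have : Subgroup.zpowers g = ⊤ := by
      apply Subgroup.eq_top_of_card_eq
      rw [Nat.card_zpowers, hord, Nat.card_eq_fintype_card, hcl, ht4]
    intro x; rw [this]; trivial
  have hmem := hgen (ClassGroup.mk0 ⟨_, hI0⟩)⁻¹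
  classical
  rw [mem_zpowers_iff_mem_range_orderOf, hord, Finset.mem_image] at hmem
  obtain ⟨k, hk, hgk'⟩ := hmem
  rw [Finset.mem_range] at hk
  have hprin : (Ideal.span {(a:O), (j:O) + θ} * P^k).IsPrincipal := by
    rw [← ClassGroup.mk0_eq_one_iff (mul_mem hI0 (pow_mem hP0 k))]
    have e : (⟨_, mul_mem hI0 (pow_mem hP0 k)⟩ : (Ideal O)⁰) = ⟨_, hI0⟩ * ⟨P, hP0⟩^k := rfl
    rw [e, map_mul, map_pow, ← hg, hgk', mul_inv_cancel]
  obtain ⟨γ, hγ⟩ := hprin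
  obtain ⟨x, y, -, hv⟩ := zv_repr hθ hσ hcoord huniq hsf ha h hp0 hcp k (γ := γ) (by rw [← hPdef]; exact hγ)
  have hg0 : 0 < Int.gcd x y := by
    rw [Int.gcd_pos_iff]
    by_contra hcon
    push Not at hcon
    rw [hcon.1, hcon.2] at hv
    have : (0:ℤ) < (p:ℤ)^k := by positivity
    simp at hv
    omega
  obtain ⟨r, x', y', hr, hco, hx, hy⟩ := Int.exists_gcd_one' hg0
  have hv' : |a * x'^2 + (2*j+1) * x' * y' - c * y'^2| ∣ (p:ℤ)^k := by
    refine ⟨(r:ℤ)^2, ?_⟩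
    rw [← hv, hx, hy]
    have hr2 : (r:ℤ)^2 = |(r:ℤ)^2| := (abs_of_nonneg (sq_nonneg (r:ℤ))).symm
    rw [hr2, ← abs_mul]
    congr 1; ring
  obtain ⟨l, hl, hvl⟩ : ∃ l ≤ k, |a * x'^2 + (2*j+1) * x' * y' - c * y'^2| = (p:ℤ)^l := by
    obtain ⟨l, hl, hass⟩ := (dvd_prime_pow hpp k).mp hv'
    refine ⟨l, hl, ?_⟩
    have := Int.associated_iff_natAbs.mp hass
    rw [Int.natAbs_abs] at this
    rw [Int.abs_eq_natAbs, this, Int.natAbs_of_nonneg (by positivity)]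
  have hfin := zv_main_descent hp (by omega : l ≤ t) ha hc h
    (Int.isCoprime_iff_gcd_eq_one.mpr hco) hvl
  rcases hfin with (h1 | h1) | (h1 | h1)
  · exact ⟨l, by omega, Or.inl h1⟩
  · exact ⟨t - l, by omega, Or.inl h1⟩
  · exact ⟨l, by omega, Or.inr h1⟩
  · exact ⟨t - l, by omega, Or.inr h1⟩

end ZV


section ZVC
open NumberField

lemma zv_coords (N : ℤ) (hN : 0 < N) (hsf : Squarefree (4*N^2+1))
    (K : Type) [Field K] [NumberField K]
    (hdeg : Module.finrank ℚ K = 2) (α : K) (hα : α ^ 2 = ((4*N^2+1 : ℤ) : K)) :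
    ∃ (θ : 𝓞 K) (σ : 𝓞 K →+* 𝓞 K), θ^2 = θ + (N:𝓞 K)^2 ∧ σ θ = 1 - θ ∧
      (∀ z : 𝓞 K, ∃ x y : ℤ, z = x + y * θ) ∧
      (∀ x y : ℤ, (x:𝓞 K) + y * θ = 0 → x = 0 ∧ y = 0) := by
  have hirr : ∀ q : ℚ, algebraMap ℚ K q ≠ α := by
    intro q hq
    have h1 : q^2 = ((4*N^2+1 : ℤ):ℚ) := by
      apply (algebraMap ℚ K).injective
      rw [map_pow, hq, hα]; simp
    have h2 : IsSquare (4*N^2+1) := by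
      rw [← Rat.isSquare_intCast_iff]
      exact ⟨q, by rw [← h1]; ring⟩
    obtain ⟨r, hr⟩ := h2
    have := hsf r (by rw [hr])
    rw [Int.isUnit_iff] at this
    rcases this with rfl | rfl <;> nlinarith
  have : Algebra.IsQuadraticExtension ℚ K := ⟨hdeg⟩
  obtain ⟨τ, hτ⟩ : ∃ τ : K ≃ₐ[ℚ] K, τ α ≠ α := by
    by_contra hcon
    push Not at hcon
    have := (IsGalois.mem_bot_iff_fixed (F := ℚ) (E := K) α).mpr hcon
    obtain ⟨q, hq⟩ := IntermediateField.mem_bot.mp this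
    exact hirr q hq
  have hτα : τ α = -α := by
    have : (τ α)^2 = α^2 := by rw [← map_pow, hα, map_intCast]
    rcases sq_eq_sq_iff_eq_or_eq_neg.mp this with h | h
    · exact absurd h hτ
    · exact h
  have hli : LinearIndependent ℚ ![(1:K), α] := by
    rw [LinearIndependent.pair_iff' one_ne_zero]
    intro q hq
    exact hirr q (by rw [Algebra.algebraMap_eq_smul_one]; exact hq)
  have hspan := hli.span_eq_top_of_card_eq_finrank' (by simp [hdeg])
  have huv : ∀ z : K, ∃ u v : ℚ, z = (u:K) + v * α := by
    intro z
    have : z ∈ Submodule.span ℚ (Set.range ![(1:K), α]) := by rw [hspan]; trivial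
    rw [Matrix.range_cons, Matrix.range_cons, Matrix.range_empty, Set.union_empty,
      Set.singleton_union, Submodule.mem_span_pair] at this
    obtain ⟨u, v, h⟩ := this
    refine ⟨u, v, ?_⟩
    rw [← h, Algebra.smul_def, Algebra.smul_def]; simp
  have hIntg : ∀ q : ℚ, IsIntegral ℤ (q:K) → ∃ m : ℤ, (m:ℚ) = q := by
    intro q hq
    have h1 : IsIntegral ℤ q := by
      rw [show (q:K) = algebraMap ℚ K q by simp] at hq
      exact (isIntegral_algebraMap_iff (algebraMap ℚ K).injective).mp hq
    obtain ⟨m, hm⟩ := IsIntegrallyClosed.isIntegral_iff.mp h1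
    exact ⟨m, by simpa using hm⟩
  have h2K : (2:K) ≠ 0 := two_ne_zero
  have hαK : α^2 = 4 * (N:K)^2 + 1 := by rw [hα]; push_cast; rfl
  have hθint : IsIntegral ℤ ((1+α)/2) := by
    refine ⟨Polynomial.X^2 - Polynomial.X - Polynomial.C (N^2), by monicity!, ?_⟩
    simp only [Polynomial.eval₂_sub, Polynomial.eval₂_pow, Polynomial.eval₂_X, Polynomial.eval₂_C]
    simp only [eq_intCast]
    push_cast
    field_simp
    linear_combination hαK
  obtain ⟨θ, hθ⟩ : ∃ θ : 𝓞 K, algebraMap (𝓞 K) K θ = (1+α)/2 := ⟨⟨(1+α)/2, hθint⟩, rfl⟩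
  refine ⟨θ, RingOfIntegers.mapRingHom (τ : K →+* K), ?_, ?_, ?_, ?_⟩
  · apply RingOfIntegers.ext
    simp only [map_pow, map_add, hθ, map_intCast]
    field_simp
    linear_combination hαK
  · apply RingOfIntegers.ext
    change τ (algebraMap (𝓞 K) K θ) = algebraMap (𝓞 K) K (1 - θ)
    simp only [map_sub, map_one, hθ]
    simp only [map_div₀, map_add, map_one, hτα, map_ofNat]
    field_simp
    ring
  · intro z
    obtain ⟨u, v, h⟩ := huv (z:K)
    have hz : IsIntegral ℤ (z:K) := z.isIntegral_coe
    have hτz : τ (z:K) = (u:K) - v * α := by rw [h]; simp [hτα, sub_eq_add_neg]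
    have hz' : IsIntegral ℤ (τ (z:K)) := hz.map (τ : K →ₐ[ℚ] K)
    have htr := hz.add hz'
    have hnm := hz.mul hz'
    rw [hτz, h] at htr hnm
    obtain ⟨A, hA⟩ := hIntg (2*u) (by
      have e : ((2*u : ℚ):K) = (u:K) + v * α + (u - v * α) := by push_cast; ring
      rw [e]; exact htr)
    obtain ⟨B, hB⟩ := hIntg (u^2 - (4*N^2+1)*v^2) (by
      have e : ((u^2 - (4*N^2+1)*v^2 : ℚ):K) = ((u:K) + v * α) * (u - v * α) := by
        push_cast; linear_combination ((v:K)^2) * hαK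
      rw [e]; exact hnm)
    -- twice v is an integer
    have hv : ∃ C : ℤ, (C:ℚ) = 2 * v := by
      have h1 : ((4*N^2+1:ℤ):ℚ) * (2*v)^2 = ((A^2 - 4*B : ℤ):ℚ) := by
        push_cast; rw [hA, hB]; ring
      obtain ⟨w, hw⟩ : ∃ w, w = 2 * v := ⟨_, rfl⟩
      rw [← hw] at h1 ⊢
      have hden : (w.den:ℚ) ≠ 0 := by exact_mod_cast w.den_nz
      have h2 : (4*N^2+1) * w.num^2 = (A^2-4*B) * (w.den:ℤ)^2 := by
        have hwq : w * w.den = w.num := Rat.mul_den_eq_num w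
        have : ((4*N^2+1:ℤ):ℚ) * (w.num:ℚ)^2 = ((A^2 - 4*B : ℤ):ℚ) * (w.den:ℚ)^2 := by
          rw [← hwq, ← h1]; ring
        exact_mod_cast this
      have h3 : (w.den:ℤ)*(w.den:ℤ) ∣ 4*N^2+1 := by
        have hco : IsCoprime ((w.den:ℤ)*(w.den:ℤ)) (w.num^2) := by
          have : IsCoprime (w.den:ℤ) w.num := by
            rw [Int.isCoprime_iff_gcd_eq_one]
            have := w.reduced
            rw [Int.gcd_comm]
            simpa [Int.gcd, Nat.Coprime] using this
          exact (this.mul_left this).pow_right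
        exact hco.dvd_of_dvd_mul_right ⟨A^2-4*B, by rw [h2]; ring⟩
      have h4 := hsf _ h3
      have h5 : w.den = 1 := by simpa [Int.isUnit_iff_natAbs_eq] using h4
      exact ⟨w.num, Rat.den_eq_one_iff w |>.mp h5⟩
    obtain ⟨C, hC⟩ := hv
    have hpar : A^2 - (4*N^2+1) * C^2 = 4 * B := by
      have : (A:ℚ)^2 - (4*N^2+1) * C^2 = 4 * B := by rw [hA, hC, hB]; ring
      exact_mod_cast this
    have hAC : ∃ x, A = 2 * x + C := by
      have h0 : (A - C) % 2 = 0 := by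
        have h1 : (A - C) * (A + C) = 2 * (2 * B + 2 * N^2 * C^2) := by linear_combination hpar
        have h2 : (2:ℤ) ∣ (A-C) * (A+C) := ⟨_, h1⟩
        rcases Int.prime_two.dvd_or_dvd h2 with h | h <;> omega
      exact ⟨(A-C)/2, by omega⟩
    obtain ⟨x, hx⟩ := hAC
    refine ⟨x, C, ?_⟩
    apply RingOfIntegers.ext
    simp only [map_add, map_mul, hθ, map_intCast]
    rw [h]
    have e1 : (2:K) * u = A := by exact_mod_cast (congrArg (fun q : ℚ => (q:K)) hA).symm
    have e2 : (2:K) * v = C := by exact_mod_cast (congrArg (fun q : ℚ => (q:K)) hC).symm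
    have e3 : (A:K) = 2 * x + C := by exact_mod_cast congrArg (fun q : ℤ => (q:K)) hx
    apply mul_left_cancel₀ h2K
    field_simp
    linear_combination e1 + α * e2 + e3
    
  · intro x y h
    have h1 := congrArg (algebraMap (𝓞 K) K) h
    simp only [map_add, map_mul, hθ, map_intCast, map_zero] at h1
    have h2 : ((2 * x + y : ℚ)) • (1:K) + (y:ℚ) • α = 0 := by
      rw [Algebra.smul_def, Algebra.smul_def]
      simp only [map_add, map_mul, map_ofNat, map_intCast]
      field_simp at h1
      linear_combination h1
    obtain ⟨a1, a2⟩ := LinearIndependent.pair_iff.mp hli _ _ h2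
    have hy : y = 0 := by exact_mod_cast a2
    subst hy
    refine ⟨?_, rfl⟩
    have : (x:ℚ) = 0 := by linarith
    exact_mod_cast this

end ZVC

section ZVB

lemma zv_sum_sym (M : ℕ) (A B C : ℚ) :
    ∑ i ∈ Finset.Ico (-(M:ℤ)) (M:ℤ), (A + B * (i:ℚ) + C * (i:ℚ)^2)
      = 2 * M * A - M * B + C * (M * (2 * M^2 + 1) / 3) := by
  induction M with
  | zero => simp
  | succ M ih =>
    have : Finset.Ico (-((M+1:ℕ):ℤ)) ((M+1:ℕ):ℤ)
        = insert (-((M:ℤ)+1)) (insert (M:ℤ) (Finset.Ico (-(M:ℤ)) (M:ℤ))) := by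
      ext x; simp only [Finset.mem_Ico, Finset.mem_insert]; push_cast; omega
    rw [this, Finset.sum_insert, Finset.sum_insert, ih]
    · push_cast; ring
    · simp
    · simp only [Finset.mem_Ico, Finset.mem_insert]; omega

lemma zv_sum_dvd (m M : ℕ) (hm : 0 < m) (g : ℤ → ℚ) :
    ∑ j ∈ Finset.Ico (-((m * M : ℕ):ℤ)) ((m*M:ℕ):ℤ), (if (m:ℤ) ∣ j then g j else 0)
      = ∑ i ∈ Finset.Ico (-(M:ℤ)) (M:ℤ), g (m * i) := by
  rw [← Finset.sum_filter]
  symm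
  have hm' : (0:ℤ) < m := by exact_mod_cast hm
  refine Finset.sum_bij (fun i _ => (m:ℤ) * i) ?_ ?_ ?_ ?_
  · intro i hi
    simp only [Finset.mem_Ico, Finset.mem_filter] at hi ⊢
    push_cast
    exact ⟨⟨by nlinarith, by nlinarith⟩, dvd_mul_right _ _⟩
  · intro i _ i' _ h
    exact mul_left_cancel₀ hm'.ne' h
  · intro j hj
    simp only [Finset.mem_Ico, Finset.mem_filter] at hj
    obtain ⟨⟨h1, h2⟩, i, rfl⟩ := hj
    push_cast at h1 h2
    refine ⟨i, ?_, rfl⟩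
    simp only [Finset.mem_Ico]
    constructor <;> by_contra hcon <;> push Not at hcon <;> nlinarith
  · intro i _; rfl

lemma zv_sum_refl (N : ℤ) (g : ℤ → ℚ) :
    ∑ j ∈ Finset.Ico (-N) N, g (-1 - j) = ∑ j ∈ Finset.Ico (-N) N, g j := by
  refine Finset.sum_bij (fun j _ => -1 - j) ?_ ?_ ?_ ?_
  · intro j hj; simp only [Finset.mem_Ico] at hj ⊢; omega
  · intro j _ j' _ h; simpa using h
  · intro j hj; refine ⟨-1 - j, ?_, by ring⟩
    simp only [Finset.mem_Ico] at hj ⊢; omega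
  · intro j _; rfl

lemma zv_sum_one (m M : ℕ) (hm : 0 < m) :
    ∑ j ∈ Finset.Ico (-((m * M : ℕ):ℤ)) ((m*M:ℕ):ℤ), (if (m:ℤ) ∣ j then
      (m:ℚ) + (((m*M:ℕ):ℚ)^2 - j * (j+1)) / m else 0)
      = 5 / 3 * ((m:ℚ) * M) + 4/3 * ((m:ℚ) * M) * (M:ℚ)^2 + M := by
  rw [zv_sum_dvd m M hm (fun j => (m:ℚ) + (((m*M:ℕ):ℚ)^2 - j * (j+1)) / m)]
  have hm' : (m:ℚ) ≠ 0 := by exact_mod_cast hm.ne'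
  have : ∀ i : ℤ, (m:ℚ) + (((m*M:ℕ):ℚ)^2 - ((m * i : ℤ):ℚ) * (((m*i : ℤ):ℚ)+1)) / m
      = (m + m * M^2) + (-1) * (i:ℚ) + (-m) * (i:ℚ)^2 := by
    intro i; push_cast; field_simp; ring
  simp only [this]
  rw [zv_sum_sym]
  ring

lemma zv_sum_k {p : ℕ} (hp : p.Prime)
    (hor : ∀ (k : ℕ) (j : ℤ), (p:ℤ)^k ∣ j * (j+1) → (p:ℤ)^k ∣ j ∨ (p:ℤ)^k ∣ j + 1)
    (k : ℕ) (hk : k < 4) :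
    ∑ j ∈ Finset.Ico (-((p^4 : ℕ):ℤ)) ((p^4:ℕ):ℤ), (if (p:ℤ)^k ∣ j * (j+1) then
      (p:ℚ)^k + ((p:ℚ)^8 - j * (j+1)) / (p:ℚ)^k else 0)
      = (if k = 0 then 1 else 2) *
        (5 / 3 * (p:ℚ)^4 + 4/3 * (p:ℚ)^4 * (p:ℚ)^(2*(4-k)) + (p:ℚ)^(4-k)) := by
  have h1 := zv_sum_one (p^k) (p^(4-k)) (pow_pos hp.pos k)
  have hpp : p^k * p^(4-k) = p^4 := by rw [← pow_add]; congr 1; omega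
  have hppq : (p:ℚ)^k * p^(4-k) = p^4 := by exact_mod_cast hpp
  rw [hpp] at h1
  push_cast at h1
  rw [hppq] at h1
  have h2 := zv_sum_refl ((p:ℤ)^4) (fun j => if (p:ℤ)^k ∣ j then
      (p:ℚ)^k + (((p:ℚ)^4)^2 - j * (j+1)) / (p:ℚ)^k else 0)
  beta_reduce at h2
  rw [h1] at h2
  by_cases hk0 : k = 0
  · subst hk0
    simp only [pow_zero, one_dvd, if_true] at h1 ⊢
    push_cast
    rw [show (p:ℚ)^8 = ((p:ℚ)^4)^2 by ring, h1]
    simp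
  · have h3 : ∀ j : ℤ, (if (p:ℤ)^k ∣ j * (j+1) then
      (p:ℚ)^k + ((p:ℚ)^8 - j * (j+1)) / (p:ℚ)^k else 0) =
      (if (p:ℤ)^k ∣ j then (p:ℚ)^k + (((p:ℚ)^4)^2 - j * (j+1)) / (p:ℚ)^k else 0) +
      (if (p:ℤ)^k ∣ (-1-j) then (p:ℚ)^k +
        (((p:ℚ)^4)^2 - ((-1-j : ℤ):ℚ) * (((-1-j : ℤ):ℚ)+1)) / (p:ℚ)^k else 0) := by
      intro j
      have e1 : (p:ℤ)^k ∣ (-1-j) ↔ (p:ℤ)^k ∣ j+1 := by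
        rw [← dvd_neg]; congr! 1; ring
      have e2 : ((p:ℚ)^4)^2 - ((-1-j : ℤ):ℚ) * (((-1-j : ℤ):ℚ)+1) = (p:ℚ)^8 - j * (j+1) := by
        push_cast; ring
      rw [e2, show ((p:ℚ)^4)^2 = (p:ℚ)^8 by ring]
      simp only [e1]
      by_cases a1 : (p:ℤ)^k ∣ j
      · have a2 : ¬ (p:ℤ)^k ∣ j + 1 := by
          intro a2
          have := (Int.dvd_add_right a1).mp a2
          have h5 : (p:ℤ) ∣ 1 := (dvd_pow_self _ hk0).trans this
          exact (Nat.prime_iff_prime_int.mp hp).not_dvd_one h5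
        simp [a1, a2, Dvd.dvd.mul_right a1]
      · by_cases a2 : (p:ℤ)^k ∣ j + 1
        · simp [a1, a2, Dvd.dvd.mul_left a2]
        · have : ¬ (p:ℤ)^k ∣ j * (j+1) := fun h => (hor k j h).elim a1 a2
          simp [a1, a2, this]
    push_cast
    rw [Finset.sum_congr rfl (fun j _ => h3 j), Finset.sum_add_distrib, h1, h2, if_neg hk0]
    ring

lemma zv_sigma {p : ℕ} (hp : p.Prime)
    (hor : ∀ (k : ℕ) (j : ℤ), (p:ℤ)^k ∣ j * (j+1) → (p:ℤ)^k ∣ j ∨ (p:ℤ)^k ∣ j + 1)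
    (H : ∀ a c j : ℤ, 0 < a → 0 < c → a * c + j * (j+1) = ((p:ℤ)^4)^2 →
      ∃ k ≤ 4, a = (p:ℤ)^k ∨ c = (p:ℤ)^k) (j : ℤ) (hj1 : -(p:ℤ)^4 ≤ j) (hj2 : j < (p:ℤ)^4) :
    ∑ e ∈ Nat.divisors (((p:ℤ)^8 - j * (j+1)).toNat), (e:ℚ) =
      ∑ k ∈ Finset.range 4, (if (p:ℤ)^k ∣ j * (j+1) then
        (p:ℚ)^k + ((p:ℚ)^8 - j * (j+1)) / (p:ℚ)^k else 0)
      + ((if j = 0 then (p:ℚ)^4 else 0) + (if j = -1 then (p:ℚ)^4 else 0)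
        - (if j = (p:ℤ)^4 - 1 then (p:ℚ) + p^2 + p^3 else 0)
        - (if j = -(p:ℤ)^4 then (p:ℚ) + p^2 + p^3 else 0)) := by
  have hp2 : (2:ℤ) ≤ p := by exact_mod_cast hp.two_le
  have hpq : (p:ℚ) ≠ 0 := by exact_mod_cast hp.ne_zero
  have hN : (16:ℤ) ≤ (p:ℤ)^4 := by
    have := pow_le_pow_left₀ (by norm_num) hp2 4
    linarith
  obtain ⟨N, hNe⟩ : ∃ N, N = (p:ℤ)^4 := ⟨_, rfl⟩
  have hdN : ∀ k < 4, (p:ℤ)^k ∣ N := fun k hk => hNe ▸ pow_dvd_pow _ hk.le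
  rw [← hNe] at hj1 hj2 hN
  by_cases hc1 : j = 0 ∨ j = -1
  · have e0 : j * (j+1) = 0 := by rcases hc1 with rfl | rfl <;> ring
    have e0q : (j:ℚ) * (j+1) = 0 := by exact_mod_cast e0
    have ec : ((if j = 0 then (p:ℚ)^4 else 0) + (if j = -1 then (p:ℚ)^4 else 0)
        - (if j = (p:ℤ)^4 - 1 then (p:ℚ) + p^2 + p^3 else 0)
        - (if j = -(p:ℤ)^4 then (p:ℚ) + p^2 + p^3 else 0)) = (p:ℚ)^4 := by
      rw [← hNe, if_neg (by omega : ¬ j = N - 1), if_neg (by omega : ¬ j = -N)]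
      rcases hc1 with rfl | rfl <;> simp
    have e8 : ((p:ℤ)^8 - 0).toNat = p^8 := by
      rw [sub_zero, show (p:ℤ)^8 = ((p^8:ℕ):ℤ) by push_cast; rfl]
      exact Int.toNat_natCast _
    rw [ec, e0, e0q, e8,
      Nat.sum_divisors_prime_pow hp]
    simp only [Finset.sum_range_succ, Finset.sum_range_zero, dvd_zero, if_true]
    push_cast
    field_simp
    ring
  by_cases hc2 : j = N - 1 ∨ j = - N
  · have e0 : j * (j+1) = N^2 - N := by rcases hc2 with rfl | rfl <;> ring
    have e0q : (j:ℚ) * (j+1) = ((p:ℚ)^4)^2 - (p:ℚ)^4 := by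
      have : (j:ℚ) * (j+1) = (N:ℚ)^2 - N := by exact_mod_cast e0
      rw [this, hNe]; push_cast; rfl
    have ec : ((if j = 0 then (p:ℚ)^4 else 0) + (if j = -1 then (p:ℚ)^4 else 0)
        - (if j = (p:ℤ)^4 - 1 then (p:ℚ) + p^2 + p^3 else 0)
        - (if j = -(p:ℤ)^4 then (p:ℚ) + p^2 + p^3 else 0)) = -((p:ℚ) + p^2 + p^3) := by
      rw [← hNe, if_neg (by omega : ¬ j = 0), if_neg (by omega : ¬ j = -1)]
      rcases hc2 with h | h
      · rw [if_pos h, if_neg (by omega)]; ring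
      · rw [if_pos h, if_neg (by omega)]; ring
    rw [ec, e0q, e0, show ((p:ℤ)^8 - (N^2 - N)).toNat = p^4 by
      rw [hNe, show (p:ℤ)^8 - (((p:ℤ)^4)^2-(p:ℤ)^4) = ((p^4:ℕ):ℤ) by push_cast; ring,
        Int.toNat_natCast],
      Nat.sum_divisors_prime_pow hp]
    have hd : ∀ k < 4, (p:ℤ)^k ∣ N^2 - N := fun k hk =>
      dvd_sub (dvd_pow (hdN k hk) (by norm_num)) (hdN k hk)
    rw [Finset.sum_congr rfl (fun k hk => if_pos (hd k (Finset.mem_range.mp hk)))]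
    simp only [Finset.sum_range_succ, Finset.sum_range_zero]
    push_cast
    field_simp
    ring
  -- generic case
  push Not at hc1 hc2
  have ec : ((if j = 0 then (p:ℚ)^4 else 0) + (if j = -1 then (p:ℚ)^4 else 0)
        - (if j = (p:ℤ)^4 - 1 then (p:ℚ) + p^2 + p^3 else 0)
        - (if j = -(p:ℤ)^4 then (p:ℚ) + p^2 + p^3 else 0)) = 0 := by
    rw [← hNe, if_neg hc1.1, if_neg hc1.2, if_neg hc2.1, if_neg hc2.2]; ring
  rw [ec, add_zero]
  have hnd : ¬ (p:ℤ)^4 ∣ j * (j+1) := by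
    intro h
    rcases hor 4 j h with ⟨i, hi⟩ | ⟨i, hi⟩
    · rw [← hNe] at hi
      have : i < 1 := by by_contra hcon; nlinarith
      have : -1 ≤ i := by by_contra hcon; nlinarith
      have : i = 0 ∨ i = -1 := by omega
      rcases this with rfl | rfl
      · exact hc1.1 (by linarith)
      · exact hc2.2 (by linarith)
    · rw [← hNe] at hi
      have : i < 2 := by by_contra hcon; nlinarith
      have : 0 ≤ i := by by_contra hcon; nlinarith
      have : i = 0 ∨ i = 1 := by omega
      rcases this with rfl | rfl
      · exact hc1.2 (by linarith)
      · exact hc2.1 (by linarith)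
  have hjj : j * (j+1) ≤ N^2 - N := by nlinarith
  obtain ⟨D, hD⟩ : ∃ D : ℕ, (D:ℤ) = (p:ℤ)^8 - j * (j+1) :=
    ⟨((p:ℤ)^8 - j * (j+1)).toNat, Int.toNat_of_nonneg (by
      rw [show (p:ℤ)^8 = N^2 by rw [hNe]; ring]; linarith)⟩
  have hDN : N ≤ D := by
    rw [hD, show (p:ℤ)^8 = N^2 by rw [hNe]; ring]; linarith
  have hD0 : D ≠ 0 := by rintro rfl; push_cast at hDN; linarith
  rw [← hD, Int.toNat_natCast]
  have hDq : (p:ℚ)^8 - j * (j+1) = (D:ℚ) := by exact_mod_cast hD.symm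
  have hdvd : ∀ k ≤ 4, ((p:ℤ)^k ∣ j * (j+1) ↔ p^k ∣ D) := by
    intro k hk
    rw [← Int.natCast_dvd_natCast, hD]
    push_cast
    exact (dvd_sub_right (pow_dvd_pow _ (by omega))).symm
  have hnd' : ¬ p^4 ∣ D := fun h => hnd ((hdvd 4 le_rfl).mpr h)
  rw [hDq]
  have hcg : ∑ k ∈ Finset.range 4, (if (p:ℤ)^k ∣ j * (j+1) then
        (p:ℚ)^k + (D:ℚ) / (p:ℚ)^k else 0)
      = ∑ k ∈ Finset.range 4, (if p^k ∣ D then (p:ℚ)^k + (D:ℚ) / (p:ℚ)^k else 0) :=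
    Finset.sum_congr rfl (fun k hk => by simp only [hdvd k (Finset.mem_range.mp hk).le])
  rw [hcg, ← Finset.sum_filter, Finset.sum_add_distrib]
  have hset : D.divisors = ((Finset.range 4).filter (fun k => p^k ∣ D)).image (fun k => p^k) ∪
      ((Finset.range 4).filter (fun k => p^k ∣ D)).image (fun k => D / p^k) := by
    ext e
    simp only [Nat.mem_divisors, Finset.mem_union, Finset.mem_image, Finset.mem_filter,
      Finset.mem_range]
    constructor
    · rintro ⟨⟨c, hc⟩, _⟩
      have he0 : 0 < e := by
        rcases Nat.eq_zero_or_pos e with h | h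
        · subst h; simp at hc; exact absurd hc hD0
        · exact h
      have hc0 : 0 < c := by
        rcases Nat.eq_zero_or_pos c with h | h
        · subst h; simp at hc; exact absurd hc hD0
        · exact h
      obtain ⟨k, hk, h⟩ := H e c j (by exact_mod_cast he0) (by exact_mod_cast hc0) (by
        have : (D:ℤ) = e * c := by exact_mod_cast hc
        rw [← this, hD]; ring)
      rcases h with h | h
      · left
        have h' : e = p^k := by exact_mod_cast h
        have hkd : p^k ∣ D := ⟨c, by rw [← h']; exact hc⟩
        have hk4 : k ≠ 4 := by rintro rfl; exact hnd' hkd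
        exact ⟨k, ⟨by omega, hkd⟩, h'.symm⟩
      · right
        have h' : c = p^k := by exact_mod_cast h
        have hkd : p^k ∣ D := ⟨e, by rw [← h', mul_comm]; exact hc⟩
        have hk4 : k ≠ 4 := by rintro rfl; exact hnd' hkd
        refine ⟨k, ⟨by omega, hkd⟩, ?_⟩
        rw [← h', hc]; exact Nat.mul_div_cancel _ hc0
    · rintro (⟨k, ⟨_, hk⟩, rfl⟩ | ⟨k, ⟨_, hk⟩, rfl⟩)
      · exact ⟨hk, hD0⟩
      · exact ⟨Nat.div_dvd_of_dvd hk, hD0⟩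
  rw [hset, Finset.sum_union, Finset.sum_image, Finset.sum_image]
  · congr 1
    · push_cast; rfl
    · refine Finset.sum_congr rfl fun k hk => ?_
      rw [Nat.cast_div (Finset.mem_filter.mp hk).2 (by push_cast; exact pow_ne_zero _ hpq)]
      push_cast; rfl
  · intro k hk l hl h
    simp only [Finset.coe_filter, Set.mem_ofPred_eq] at hk hl
    have h' : D / p^k = D / p^l := h
    have e1 := Nat.div_mul_cancel hk.2
    have e2 := Nat.div_mul_cancel hl.2
    rw [h', ← e2] at e1
    rw [e2] at e1
    have h3 : D / p^l ≠ 0 := by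
      intro h0; rw [h0] at e2; simp at e2; exact hD0 e2.symm
    have h4 : D / p^l * p^k = D / p^l * p^l := by rw [e1, e2]
    exact Nat.pow_right_injective hp.two_le (mul_left_cancel₀ h3 h4)
  · intro k _ l _ h
    exact Nat.pow_right_injective hp.two_le h
  · rw [Finset.disjoint_left]
    rintro e h1 h2
    simp only [Finset.mem_image, Finset.mem_filter, Finset.mem_range] at h1 h2
    obtain ⟨k, ⟨hk, hkd⟩, rfl⟩ := h1
    obtain ⟨l, ⟨hl, hld⟩, h⟩ := h2
    have e1 := Nat.div_mul_cancel hld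
    rw [h, ← pow_add] at e1
    by_cases hkl : 4 ≤ k + l
    · exact hnd' (e1 ▸ pow_dvd_pow _ hkl)
    · have h5 : p^(k+l) < p^4 := Nat.pow_lt_pow_right hp.one_lt (by omega)
      rw [e1] at h5
      have : (D:ℤ) < N := by rw [hNe]; exact_mod_cast h5
      linarith

lemma zv_total {p : ℕ} (hp : p.Prime)
    (hor : ∀ (k : ℕ) (j : ℤ), (p:ℤ)^k ∣ j * (j+1) → (p:ℤ)^k ∣ j ∨ (p:ℤ)^k ∣ j + 1)
    (H : ∀ a c j : ℤ, 0 < a → 0 < c → a * c + j * (j+1) = ((p:ℤ)^4)^2 →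
      ∃ k ≤ 4, a = (p:ℤ)^k ∨ c = (p:ℤ)^k)
    (n : ℕ) (hn : n = 2 * p ^ 4) (d : ℕ) (hd : d = n ^ 2 + 1) :
    (1 / 60 : ℚ) *
      ∑ x ∈ (Finset.Icc (-(d : ℤ)) (d : ℤ)).filter
          (fun x => x ^ 2 < (d : ℤ) ∧ x ^ 2 % 4 = (d : ℤ) % 4),
        ∑ e ∈ Nat.divisors (((d : ℤ) - x ^ 2).toNat / 4), (e : ℚ)
    = ((n : ℚ) ^ 3 + 14 * n) / 360
      + ((n : ℚ) ^ 3 + n * (4 * (p : ℚ) ^ 4 + 10 * p ^ 2)) / (180 * p ^ 2)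
      + ((n : ℚ) ^ 3 + n * (4 * (p : ℚ) ^ 8 + 10 * p ^ 4)) / (360 * p ^ 4) := by
  have hpq : (p:ℚ) ≠ 0 := by exact_mod_cast hp.ne_zero
  have hp2 : (2:ℤ) ≤ p := by exact_mod_cast hp.two_le
  have hN : (16:ℤ) ≤ (p:ℤ)^4 := by
    have := pow_le_pow_left₀ (by norm_num) hp2 4
    linarith
  have hdz : (d:ℤ) = 4 * ((p:ℤ)^4)^2 + 1 := by rw [hd, hn]; push_cast; ring
  have hre : ∑ x ∈ (Finset.Icc (-(d : ℤ)) (d : ℤ)).filter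
          (fun x => x ^ 2 < (d : ℤ) ∧ x ^ 2 % 4 = (d : ℤ) % 4),
        ∑ e ∈ Nat.divisors (((d : ℤ) - x ^ 2).toNat / 4), (e : ℚ)
      = ∑ j ∈ Finset.Ico (-(p:ℤ)^4) ((p:ℤ)^4),
        ∑ e ∈ Nat.divisors (((p:ℤ)^8 - j * (j+1)).toNat), (e:ℚ) := by
    symm
    obtain ⟨N, hNe⟩ : ∃ N, N = (p:ℤ)^4 := ⟨_, rfl⟩
    rw [show (p:ℤ)^8 = ((p:ℤ)^4)^2 by ring]
    rw [← hNe] at hN hdz ⊢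
    refine Finset.sum_bij (fun j _ => 2 * j + 1) ?_ ?_ ?_ ?_
    · intro j hj
      simp only [Finset.mem_Ico, Finset.mem_filter, Finset.mem_Icc] at hj ⊢
      have h1 : (2*j+1)^2 < (d:ℤ) := by rw [hdz]; nlinarith
      refine ⟨⟨by nlinarith, by nlinarith⟩, h1, ?_⟩
      rw [hdz, show (2*j+1)^2 = 4 * (j*(j+1)) + 1 by ring]
      omega
    · intro j _ j' _ h
      simpa using h
    · intro x hx
      simp only [Finset.mem_filter, Finset.mem_Icc] at hx
      obtain ⟨_, h1, h2⟩ := hx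
      have hodd : x % 2 = 1 := by
        rcases Int.emod_two_eq_zero_or_one x with h | h
        · exfalso
          obtain ⟨y, rfl⟩ : ∃ y, x = 2 * y := ⟨x / 2, by omega⟩
          rw [hdz, show (2*y)^2 = 4 * y^2 by ring] at h2
          omega
        · exact h
      obtain ⟨j, rfl⟩ : ∃ j, x = 2 * j + 1 := ⟨x / 2, by omega⟩
      refine ⟨j, ?_, rfl⟩
      rw [hdz] at h1
      simp only [Finset.mem_Ico]
      constructor
      · by_contra hcon
        have : j + 1 ≤ -N := by omega
        nlinarith
      · by_contra hcon
        have : N ≤ j := by omega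
        nlinarith
    · intro j hj
      congr 2
      rw [hdz, show 4 * N^2 + 1 - (2*j+1)^2 = 4 * (N^2 - j*(j+1)) by ring]
      omega
  rw [hre, Finset.sum_congr rfl (fun j hj => zv_sigma hp hor H j (Finset.mem_Ico.mp hj).1
    (Finset.mem_Ico.mp hj).2), Finset.sum_add_distrib, Finset.sum_comm]
  have hk := fun k hk => zv_sum_k hp hor k hk
  push_cast at hk
  rw [Finset.sum_congr rfl (fun k h => hk k (Finset.mem_range.mp h))]
  have hcorr : ∑ j ∈ Finset.Ico (-(p:ℤ)^4) ((p:ℤ)^4),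
      ((if j = 0 then (p:ℚ)^4 else 0) + (if j = -1 then (p:ℚ)^4 else 0)
        - (if j = (p:ℤ)^4 - 1 then (p:ℚ) + p^2 + p^3 else 0)
        - (if j = -(p:ℤ)^4 then (p:ℚ) + p^2 + p^3 else 0))
      = 2 * (p:ℚ)^4 - 2 * (p + p^2 + p^3) := by
    rw [Finset.sum_sub_distrib, Finset.sum_sub_distrib, Finset.sum_add_distrib,
      Finset.sum_ite_eq', Finset.sum_ite_eq', Finset.sum_ite_eq', Finset.sum_ite_eq',
      if_pos, if_pos, if_pos, if_pos]
    · ring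
    all_goals (simp only [Finset.mem_Ico]; omega)
  rw [hcorr, hn]
  simp only [Finset.sum_range_succ, Finset.sum_range_zero]
  push_cast
  norm_num
  field_simp
  ring

end ZVB

/-- If `n = 2 * p^t` with `p` an odd prime and `t ≥ 3`, `d = n^2 + 1` is
squarefree with `d ≡ 5 (mod 8)`, and the class number of `ℚ(√d)` is `4`, then
the Siegel–Zagier expression `(1/60) * Σ σ((d - x^2)/4)` (the sum over
integers `x` with `x^2 < d` and `x^2 ≡ d (mod 4)`), which equals
`ζ_{ℚ(√d)}(-1)`, is
`(n³+14n)/360 + (n³+n(4p⁴+10p²))/(180p²) + (n³+n(4p⁸+10p⁴))/(360p⁴)`. -/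
theorem zeta_value_of_two_mul_prime_pow
    (p : ℕ) (hp : p.Prime) (hodd : p ≠ 2) (t : ℕ) (ht : 3 ≤ t)
    (n : ℕ) (hn : n = 2 * p ^ t) (d : ℕ) (hd : d = n ^ 2 + 1)
    (hsf : Squarefree d) (hmod : d % 8 = 5)
    (K : Type) [Field K] [NumberField K]
    (hdeg : Module.finrank ℚ K = 2) (α : K) (hα : α ^ 2 = (d : K))
    (hcl : NumberField.classNumber K = 4) :
    (1 / 60 : ℚ) *
      ∑ x ∈ (Finset.Icc (-(d : ℤ)) (d : ℤ)).filter
          (fun x => x ^ 2 < (d : ℤ) ∧ x ^ 2 % 4 = (d : ℤ) % 4),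
        ∑ e ∈ Nat.divisors (((d : ℤ) - x ^ 2).toNat / 4), (e : ℚ)
    = ((n : ℚ) ^ 3 + 14 * n) / 360
      + ((n : ℚ) ^ 3 + n * (4 * (p : ℚ) ^ 4 + 10 * p ^ 2)) / (180 * p ^ 2)
      + ((n : ℚ) ^ 3 + n * (4 * (p : ℚ) ^ 8 + 10 * p ^ 4)) / (360 * p ^ 4) := by
  have hdN : (d:ℤ) = 4*((p:ℤ)^t)^2+1 := by rw [hd, hn]; push_cast; ring
  have hsf' : Squarefree (4*((p:ℤ)^t)^2+1) := by
    rw [← hdN]; exact Int.squarefree_natCast.mpr hsf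
  have hN : (0:ℤ) < (p:ℤ)^t := pow_pos (by exact_mod_cast hp.pos) t
  obtain ⟨θ, σ, hθ, hσ, hc, hu⟩ := zv_coords ((p:ℤ)^t) hN hsf' K hdeg α
    (by rw [hα, ← hdN]; simp)
  obtain ⟨ht4, H⟩ := zv_class (O := NumberField.RingOfIntegers K) hcl hp ht hθ hσ hc hu hsf'
  subst ht4
  exact zv_total hp (zv_dvd_or hp) H n hn d hd
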